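/- arXiv:2012.10304 — 3 statements merged into one kernel-verified Lean document; each statement's English description precedes it below -/
import Mathlib

section
/- Fix real numbers x2, x3, y1, y2, y3 with Y ≠ 0 (where Y := x2 − y2). Then for every real x1, setting X := x1 − y1, Z := x3 − y3 and R := sqrt(X² + Y² + Z²), the function x1 ↦ X·atanh(Z/R) + Z·atanh(X/R) − Y·atan((Z/R)·(X/Y)) has derivative atanh(Z/R) at x1. -/
/-- The real inverse hyperbolic tangent. -/
noncomputable def atanh (x : ℝ) : ℝ := Real.log ((1 + x) / (1 - x)) / 2

theorem hasDerivAt_atanh_aux {u : ℝ} (hu : u ^ 2 < 1) :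
    HasDerivAt atanh (1 / (1 - u ^ 2)) u := by
  have h1 : 0 < 1 - u := by nlinarith
  have h2 : 0 < 1 + u := by nlinarith
  have h3 : 1 - u ^ 2 ≠ 0 := by nlinarith
  have a : HasDerivAt (fun x : ℝ => 1 + x) 1 u := (hasDerivAt_id u).const_add 1
  have b : HasDerivAt (fun x : ℝ => 1 - x) (-1) u := (hasDerivAt_id u).const_sub 1
  have c := ((a.fun_div b h1.ne').log (by positivity)).div_const 2
  unfold atanh
  refine c.congr_deriv ?_
  have e : 1 - u ^ 2 = (1 - u) * (1 + u) := by ring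
  rw [e]
  field_simp
  ring

theorem stmt_4 (x2 x3 y1 y2 y3 : ℝ) (h : x2 - y2 ≠ 0) (x1 : ℝ) :
    HasDerivAt (fun t : ℝ =>
        (t - y1) * atanh ((x3 - y3) / Real.sqrt ((t - y1) ^ 2 + (x2 - y2) ^ 2 + (x3 - y3) ^ 2))
          + (x3 - y3) * atanh ((t - y1) / Real.sqrt ((t - y1) ^ 2 + (x2 - y2) ^ 2 + (x3 - y3) ^ 2))
          - (x2 - y2) * Real.arctan
              ((x3 - y3) / Real.sqrt ((t - y1) ^ 2 + (x2 - y2) ^ 2 + (x3 - y3) ^ 2)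
                * ((t - y1) / (x2 - y2))))
      (atanh ((x3 - y3) / Real.sqrt ((x1 - y1) ^ 2 + (x2 - y2) ^ 2 + (x3 - y3) ^ 2))) x1 := by
  have hd : HasDerivAt (fun t : ℝ => t - y1) 1 x1 := (hasDerivAt_id x1).sub_const y1
  have hpos : 0 < (x1 - y1) ^ 2 + (x2 - y2) ^ 2 + (x3 - y3) ^ 2 := by positivity
  have hR0 := (((hd.fun_pow 2).add_const ((x2 - y2) ^ 2)).add_const ((x3 - y3) ^ 2)).sqrt hpos.ne'
  have hRpos := Real.sqrt_pos.2 hpos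
  have hRsq := Real.sq_sqrt hpos.le
  generalize x2 - y2 = Y at *
  generalize x3 - y3 = Z at *
  have hZ := (hasDerivAt_const x1 Z).fun_div hR0 hRpos.ne'
  have hX := hd.fun_div hR0 hRpos.ne'
  have hY2 : 0 < Y ^ 2 := by positivity
  have uZ : (Z / √((x1 - y1) ^ 2 + Y ^ 2 + Z ^ 2)) ^ 2 < 1 := by
    rw [div_pow, hRsq, div_lt_one hpos]; nlinarith [sq_nonneg (x1 - y1)]
  have uX : ((x1 - y1) / √((x1 - y1) ^ 2 + Y ^ 2 + Z ^ 2)) ^ 2 < 1 := by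
    rw [div_pow, hRsq, div_lt_one hpos]; nlinarith [sq_nonneg Z]
  have h1 := (hasDerivAt_atanh_aux uZ).comp x1 hZ
  have h2 := (hasDerivAt_atanh_aux uX).comp x1 hX
  have h3 := (hZ.fun_mul (hd.div_const Y)).arctan
  refine (((hd.fun_mul h1).fun_add (h2.const_mul Z)).fun_sub (h3.const_mul Y)).congr_deriv ?_
  simp only [Function.comp]
  generalize √((x1 - y1) ^ 2 + Y ^ 2 + Z ^ 2) = R at *
  generalize x1 - y1 = X at *
  clear h1 h2 h3 hZ hX hR0 hd uZ uX
  have hXY : 0 < X ^ 2 + Y ^ 2 := by positivity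
  have hYZ : 0 < Y ^ 2 + Z ^ 2 := by positivity
  have e1 : 1 - (Z / R) ^ 2 = (X ^ 2 + Y ^ 2) / R ^ 2 := by
    field_simp; linarith
  have e2 : 1 - (X / R) ^ 2 = (Y ^ 2 + Z ^ 2) / R ^ 2 := by
    field_simp; linarith
  have e3 : 1 + (Z / R * (X / Y)) ^ 2 = (X ^ 2 + Y ^ 2) * (Y ^ 2 + Z ^ 2) / (R ^ 2 * Y ^ 2) := by
    field_simp; rw [hRsq]; ring
  have t1 : 1 / (1 - (Z / R) ^ 2) * ((0 * R - Z * (2 * X / (2 * R))) / R ^ 2)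
      = - (Z * X) / (R * (X ^ 2 + Y ^ 2)) := by
    rw [e1]; field_simp; ring
  have t2 : 1 / (1 - (X / R) ^ 2) * ((1 * R - X * (2 * X / (2 * R))) / R ^ 2) = 1 / R := by
    rw [e2]; field_simp; linarith
  have t3 : 1 / (1 + (Z / R * (X / Y)) ^ 2) *
      ((0 * R - Z * (2 * X / (2 * R))) / R ^ 2 * (X / Y) + Z / R * (1 / Y))
      = Z * Y / (R * (X ^ 2 + Y ^ 2)) := by
    have e4 : (0 * R - Z * (2 * X / (2 * R))) / R ^ 2 * (X / Y) + Z / R * (1 / Y)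
        = Z * (Y ^ 2 + Z ^ 2) / (R ^ 3 * Y) := by
      field_simp; rw [hRsq]; ring
    rw [e3, e4]; field_simp
  have n : (↑(2:ℕ) * X ^ (2 - 1) * 1 : ℝ) = 2 * X := by norm_num
  rw [n, t1, t2, t3]
  field_simp
  ring
end

section
/- Fix real numbers x2, x3, y1, y2, y3 with Y ≠ 0 (where Y := x2 − y2). Then for every real x1, setting X := x1 − y1, Z := x3 − y3 and R := sqrt(X² + Y² + Z²), the function x1 ↦ X·atan((X/R)·(Z/Y)) + Y·atanh(Z/R) has derivative atan((X/R)·(Z/Y)) at x1. -/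
theorem atanh_hasDerivAt (x : ℝ) (h1 : -1 < x) (h2 : x < 1) :
    HasDerivAt atanh (1 / (1 - x ^ 2)) x := by
  have a : 1 + x ≠ 0 := by linarith
  have b : 1 - x ≠ 0 := by linarith
  have c : 1 - x ^ 2 ≠ 0 := by
    have : 1 - x ^ 2 = (1 + x) * (1 - x) := by ring
    rw [this]; exact mul_ne_zero a b
  have e := ((((hasDerivAt_id x).const_add 1).div ((hasDerivAt_id x).const_sub 1) b).log
    (div_ne_zero a b)).div_const 2
  refine HasDerivAt.congr_deriv e ?_
  simp only [id, Pi.div_apply]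
  have c' : 1 - x ^ 2 = (1 + x) * (1 - x) := by ring
  rw [c']
  field_simp
  ring

theorem stmt_6 (x2 x3 y1 y2 y3 : ℝ) (h : x2 - y2 ≠ 0) (x1 : ℝ) :
    HasDerivAt (fun t : ℝ =>
        (t - y1) * Real.arctan
            ((t - y1) / Real.sqrt ((t - y1) ^ 2 + (x2 - y2) ^ 2 + (x3 - y3) ^ 2)
              * ((x3 - y3) / (x2 - y2)))
          + (x2 - y2) * atanh ((x3 - y3) / Real.sqrt ((t - y1) ^ 2 + (x2 - y2) ^ 2 + (x3 - y3) ^ 2)))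
      (Real.arctan
        ((x1 - y1) / Real.sqrt ((x1 - y1) ^ 2 + (x2 - y2) ^ 2 + (x3 - y3) ^ 2)
          * ((x3 - y3) / (x2 - y2)))) x1 := by
  generalize x2 - y2 = Y at *
  generalize x3 - y3 = Z at *
  have hY : 0 < Y ^ 2 := by positivity
  have hS : 0 < (x1 - y1) ^ 2 + Y ^ 2 + Z ^ 2 := by positivity
  have hX : HasDerivAt (fun t : ℝ => t - y1) 1 x1 := (hasDerivAt_id x1).sub_const y1
  have hR : HasDerivAt (fun t : ℝ => Real.sqrt ((t - y1) ^ 2 + Y ^ 2 + Z ^ 2))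
      ((x1 - y1) / Real.sqrt ((x1 - y1) ^ 2 + Y ^ 2 + Z ^ 2)) x1 := by
    refine ((((hX.pow 2).add_const (Y ^ 2)).add_const (Z ^ 2)).sqrt hS.ne').congr_deriv ?_
    simp only [Pi.pow_apply]
    have := Real.sqrt_pos.2 hS
    field_simp
    norm_num
    ring
  have hRp := Real.sqrt_pos.2 hS
  have hR2 := Real.sq_sqrt hS.le
  have hb : |Z / Real.sqrt ((x1 - y1) ^ 2 + Y ^ 2 + Z ^ 2)| < 1 := by
    rw [abs_div, abs_of_pos hRp, div_lt_one hRp]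
    apply Real.lt_sqrt_of_sq_lt
    rw [sq_abs]; nlinarith [sq_nonneg (x1 - y1)]
  have hu := ((hX.div hR hRp.ne').mul_const (Z / Y)).arctan
  have hv := (atanh_hasDerivAt _ (abs_lt.1 hb).1 (abs_lt.1 hb).2).comp x1
    ((hasDerivAt_const x1 Z).div hR hRp.ne')
  refine ((hX.mul hu).add (hv.const_mul Y)).congr_deriv ?_
  simp only [Pi.div_apply]
  generalize Real.sqrt ((x1 - y1) ^ 2 + Y ^ 2 + Z ^ 2) = R at *
  generalize x1 - y1 = X at *
  have e1 : 1 + (X / R * (Z / Y)) ^ 2 = (X ^ 2 + Y ^ 2) * (Y ^ 2 + Z ^ 2) / (R ^ 2 * Y ^ 2) := by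
    field_simp
    rw [hR2]; ring
  have e2 : 1 - (Z / R) ^ 2 = (X ^ 2 + Y ^ 2) / R ^ 2 := by
    field_simp
    rw [hR2]; ring
  have e3 : 1 * R - X * (X / R) = (Y ^ 2 + Z ^ 2) / R := by
    field_simp
    rw [hR2]; ring
  rw [e1, e2, e3]
  have p1 : X ^ 2 + Y ^ 2 ≠ 0 := by positivity
  have p2 : Y ^ 2 + Z ^ 2 ≠ 0 := by positivity
  have hR0 := hRp.ne'
  field_simp
  ring
end

section
/- Fix real numbers x1, x2, x3, y2, y3 with Y ≠ 0 (where Y := x2 − y2). Then for every real y1, setting X := x1 − y1, Z := x3 − y3 and R := sqrt(X² + Y² + Z²), the function y1 ↦ −X·atanh(Z/R) − Z·atanh(X/R) + Y·atan((Z/R)·(X/Y)) has derivative atanh(Z/R) at y1. -/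
theorem atanh_hasDerivAt_s10 {f : ℝ → ℝ} {f' t : ℝ} (hf : HasDerivAt f f' t) (h : f t ^ 2 < 1) :
    HasDerivAt (fun s => atanh (f s)) (f' / (1 - f t ^ 2)) t := by
  have h1 : 0 < 1 + f t := by nlinarith
  have h2 : 0 < 1 - f t := by nlinarith
  have h3 : 1 - f t ^ 2 ≠ 0 := by linarith
  unfold atanh
  have := (((hf.const_add 1).div (hf.const_sub 1) h2.ne').log (div_pos h1 h2).ne').div_const 2
  refine this.congr_deriv ?_
  have h4 : 1 - f t ^ 2 = (1 + f t) * (1 - f t) := by ring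
  rw [h4]
  simp only [Pi.div_apply]
  field_simp
  ring

theorem stmt_10 (x1 x2 x3 y2 y3 : ℝ) (h : x2 - y2 ≠ 0) (y1 : ℝ) :
    HasDerivAt (fun t : ℝ =>
        -((x1 - t) * atanh ((x3 - y3) / Real.sqrt ((x1 - t) ^ 2 + (x2 - y2) ^ 2 + (x3 - y3) ^ 2)))
          - (x3 - y3) * atanh ((x1 - t) / Real.sqrt ((x1 - t) ^ 2 + (x2 - y2) ^ 2 + (x3 - y3) ^ 2))
          + (x2 - y2) * Real.arctan
              ((x3 - y3) / Real.sqrt ((x1 - t) ^ 2 + (x2 - y2) ^ 2 + (x3 - y3) ^ 2)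
                * ((x1 - t) / (x2 - y2))))
      (atanh ((x3 - y3) / Real.sqrt ((x1 - y1) ^ 2 + (x2 - y2) ^ 2 + (x3 - y3) ^ 2))) y1 := by
  generalize x2 - y2 = Y at *
  generalize x3 - y3 = Z at *
  have hY : 0 < Y ^ 2 := by positivity
  have hX : HasDerivAt (fun t : ℝ => x1 - t) (-1) y1 := (hasDerivAt_id y1).const_sub x1
  have hpos : 0 < (x1 - y1) ^ 2 + Y ^ 2 + Z ^ 2 := by positivity
  have hR : HasDerivAt (fun t : ℝ => Real.sqrt ((x1 - t) ^ 2 + Y ^ 2 + Z ^ 2))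
      (-(x1 - y1) / Real.sqrt ((x1 - y1) ^ 2 + Y ^ 2 + Z ^ 2)) y1 := by
    refine ((((hX.pow 2).add_const (Y ^ 2)).add_const (Z ^ 2)).sqrt hpos.ne').congr_deriv ?_
    have := (Real.sqrt_pos.2 hpos).ne'
    simp only [Pi.pow_apply]
    field_simp
    norm_num [mul_comm]
  have hRp := Real.sqrt_pos.2 hpos
  have hsq := Real.sq_sqrt hpos.le
  have hZR := (hasDerivAt_const y1 Z).fun_div hR hRp.ne'
  have hXR := hX.fun_div hR hRp.ne'
  have b1 : (Z / Real.sqrt ((x1 - y1) ^ 2 + Y ^ 2 + Z ^ 2)) ^ 2 < 1 := by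
    rw [div_pow, hsq, div_lt_one hpos]; nlinarith [sq_nonneg (x1 - y1)]
  have b2 : ((x1 - y1) / Real.sqrt ((x1 - y1) ^ 2 + Y ^ 2 + Z ^ 2)) ^ 2 < 1 := by
    rw [div_pow, hsq, div_lt_one hpos]; nlinarith [sq_nonneg Z]
  have A := atanh_hasDerivAt_s10 hZR b1
  have B := atanh_hasDerivAt_s10 hXR b2
  have C := (hZR.fun_mul (hX.div_const Y)).arctan
  refine (((hX.fun_mul A).fun_neg.fun_sub (B.const_mul Z)).fun_add (C.const_mul Y)).congr_deriv ?_
  clear A B C hZR hXR hR b1 b2 hX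
  generalize x1 - y1 = X at *
  generalize Real.sqrt (X ^ 2 + Y ^ 2 + Z ^ 2) = R at *
  have hR0 := hRp.ne'
  have p1 : 0 < X ^ 2 + Y ^ 2 := by positivity
  have p2 : 0 < Y ^ 2 + Z ^ 2 := by positivity
  have e1 : 1 - (Z / R) ^ 2 = (X ^ 2 + Y ^ 2) / R ^ 2 := by
    field_simp; linarith
  have e2 : 1 - (X / R) ^ 2 = (Y ^ 2 + Z ^ 2) / R ^ 2 := by
    field_simp; linarith
  have e3 : 1 + (Z / R * (X / Y)) ^ 2 = (X ^ 2 + Y ^ 2) * (Y ^ 2 + Z ^ 2) / (R ^ 2 * Y ^ 2) := by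
    field_simp; rw [hsq]; ring
  have e4 : (-1 * R - X * (-X / R)) / R ^ 2 = -(Y ^ 2 + Z ^ 2) / R ^ 3 := by
    field_simp; rw [hsq]; ring
  have e5 : (0 * R - Z * (-X / R)) / R ^ 2 = Z * X / R ^ 3 := by
    field_simp; ring
  have e6 : Z * X / R ^ 3 * (X / Y) + Z / R * (-1 / Y) = - Z * (Y ^ 2 + Z ^ 2) / (R ^ 3 * Y) := by
    field_simp; rw [hsq]; ring
  rw [e1, e2, e3, e4, e5, e6]
  field_simp
  ring
end
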